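/- Let A be a strongly nicely essential subring of a ring S. If S is a semiprime (resp. prime) left Goldie ring, then A is a semiprime (resp. prime) left Goldie ring. -/

import Mathlib

universe u v

section ModuleDefs

variable {R : Type u} [Ring R] {M : Type v} [AddCommGroup M] [Module R M]

/-- `N` is an essential submodule of `M`: it meets every nonzero submodule nontrivially. -/
def IsEssentialSubmodule (N : Submodule R M) : Prop :=
  ∀ K : Submodule R M, K ≠ ⊥ → N ⊓ K ≠ ⊥

/-- `N` is an essential submodule of `P`: `N ≤ P` and `N` meets every nonzero submodule
contained in `P` nontrivially. -/
def IsEssentialIn (N P : Submodule R M) : Prop :=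
  N ≤ P ∧ ∀ K : Submodule R M, K ≤ P → K ≠ ⊥ → N ⊓ K ≠ ⊥

/-- `U` is a uniform submodule: `U ≠ ⊥` and any two nonzero submodules contained in `U`
intersect nontrivially. -/
def IsUniformSubmodule (U : Submodule R M) : Prop :=
  U ≠ ⊥ ∧ ∀ K L : Submodule R M, K ≤ U → L ≤ U → K ≠ ⊥ → L ≠ ⊥ → K ⊓ L ≠ ⊥

end ModuleDefs

/-- The uniform (Goldie) dimension of a module: the supremum of the cardinals `#ι` over all
independent families `(f i)_{i : ι}` of nonzero submodules. -/
noncomputable def udim (R : Type u) (M : Type v) [Ring R] [AddCommGroup M] [Module R M] :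
    Cardinal.{v} :=
  sSup { c : Cardinal.{v} | ∃ (ι : Type v) (f : ι → Submodule R M),
    iSupIndep f ∧ (∀ i, f i ≠ ⊥) ∧ c = Cardinal.mk ι }

/-- A ring has enough uniform left ideals if every nonzero left ideal contains a uniform
left ideal. -/
def HasEnoughUniformLeftIdeals (T : Type u) [Ring T] : Prop :=
  ∀ L : Ideal T, L ≠ ⊥ → ∃ U : Ideal T, U ≤ L ∧ IsUniformSubmodule U

/-- The left annihilator of an element, as a left ideal. -/
def lAnn (T : Type u) [Ring T] (x : T) : Ideal T where
  carrier := {t | t * x = 0}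
  add_mem' := by
    intro a b ha hb
    simp only [Set.mem_setOf_eq] at *
    rw [add_mul, ha, hb, add_zero]
  zero_mem' := by simp
  smul_mem' := by
    intro c t ht
    simp only [smul_eq_mul, Set.mem_setOf_eq] at *
    rw [mul_assoc, ht, mul_zero]

/-- The left singular ideal of a ring, as a set: the elements whose left annihilator is an
essential left ideal. -/
def singSet (T : Type u) [Ring T] : Set T := {x | IsEssentialSubmodule (lAnn T x)}

/-- The left annihilator of a set, as a left ideal. -/
def lAnnSet (T : Type u) [Ring T] (U : Set T) : Ideal T where
  carrier := {t | ∀ u ∈ U, t * u = 0}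
  add_mem' := by
    intro a b ha hb u hu
    rw [add_mul, ha u hu, hb u hu, add_zero]
  zero_mem' := by intro u hu; simp
  smul_mem' := by
    intro c t ht u hu
    simp only [smul_eq_mul]
    rw [mul_assoc, ht u hu, mul_zero]

/-- The ascending chain condition on left annihilators. -/
def ACCLeftAnnihilators (T : Type u) [Ring T] : Prop :=
  ∀ f : ℕ → Ideal T, (∀ n, ∃ U : Set T, f n = lAnnSet T U) → Monotone f →
    ∃ n, ∀ m, n ≤ m → f m = f n

/-- A ring is left Goldie if it has finite left uniform dimension (no infinite independent
family of nonzero left ideals) and the ACC on left annihilators. -/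
def IsLeftGoldie (T : Type u) [Ring T] : Prop :=
  (¬ ∃ f : ℕ → Ideal T, iSupIndep f ∧ ∀ n, f n ≠ ⊥) ∧ ACCLeftAnnihilators T

/-- A ring is prime: `I·J = 0` forces `I = 0` or `J = 0` for two-sided ideals. -/
def IsPrimeRing (T : Type u) [Ring T] : Prop :=
  ∀ I J : TwoSidedIdeal T, (∀ x ∈ I, ∀ y ∈ J, x * y = 0) → I = ⊥ ∨ J = ⊥

/-- A ring is semiprime: `I·I = 0` forces `I = 0` for two-sided ideals. -/
def IsSemiprimeRing (T : Type u) [Ring T] : Prop :=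
  ∀ I : TwoSidedIdeal T, (∀ x ∈ I, ∀ y ∈ I, x * y = 0) → I = ⊥

section Subring

variable {S : Type u} [Ring S]

/-- A subring `A` of `S`, viewed as a left `A`-submodule of `S`. -/
def Subring.selfSubmodule (A : Subring S) : Submodule A S where
  carrier := A
  add_mem' := by intro a b ha hb; exact add_mem ha hb
  zero_mem' := zero_mem _
  smul_mem' := by intro a x hx; exact mul_mem a.2 hx

/-- `A` is a nicely essential subring of `S`. -/
def Subring.NicelyEssential (A : Subring S) : Prop :=
  ∀ E : Finset S, (∀ x ∈ E, x ≠ 0) → ∃ a ∈ A, ∀ x ∈ E, a * x ∈ A ∧ a * x ≠ 0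

/-- `A` is a strongly nicely essential subring of `S`. -/
def Subring.StronglyNicelyEssential (A : Subring S) : Prop :=
  A.NicelyEssential ∧ ∀ x : S, ∃ c ∈ A, c * x ∈ A ∧ ∀ b ∈ A, b * c = 0 → b = 0

/-- The left annihilator in the subring `A` of an element `x` of the ambient ring,
as a left ideal of `A`. -/
def Subring.lAnnIn (A : Subring S) (x : S) : Ideal A where
  carrier := {b | (b : S) * x = 0}
  add_mem' := by
    intro a b ha hb
    simp only [Set.mem_setOf_eq] at *
    push_cast
    rw [add_mul, ha, hb, add_zero]
  zero_mem' := by simp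
  smul_mem' := by
    intro c t ht
    simp only [smul_eq_mul, Set.mem_setOf_eq] at *
    push_cast
    rw [mul_assoc, ht, mul_zero]

end Subring

section Semiprime

variable {T : Type u} [Ring T]

theorem mem_lAnnSet {U : Set T} {t : T} : t ∈ lAnnSet T U ↔ ∀ u ∈ U, t * u = 0 := Iff.rfl

/-- The two-sided ideal of elements `z` with `z T y = 0`. -/
def TwoSidedIdeal.sandwichAnnihilator (y : T) : TwoSidedIdeal T :=
  .mk' {z | ∀ t, z * t * y = 0} (by simp)
    (fun hx hy t => by rw [add_mul, add_mul, hx t, hy t, add_zero])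
    (fun hx t => by rw [neg_mul, neg_mul, hx t, neg_zero])
    (fun hy t => by rw [mul_assoc _ _ t, mul_assoc, hy t, mul_zero])
    (fun hx t => by rw [mul_assoc _ _ t, hx])

/-- The two-sided ideal of elements `w` with `I w = 0`. -/
def TwoSidedIdeal.rightAnnihilator (I : TwoSidedIdeal T) : TwoSidedIdeal T :=
  .mk' {w | ∀ z ∈ I, z * w = 0} (by simp)
    (fun hx hy z hz => by rw [mul_add, hx z hz, hy z hz, add_zero])
    (fun hx z hz => by rw [mul_neg, hx z hz, neg_zero])
    (fun hy z hz => by rw [← mul_assoc, hy _ (I.mul_mem_right _ _ hz)])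
    (fun hx z hz => by rw [← mul_assoc, hx z hz, zero_mul])

theorem TwoSidedIdeal.mem_sandwichAnnihilator {y z : T} :
    z ∈ sandwichAnnihilator y ↔ ∀ t, z * t * y = 0 :=
  TwoSidedIdeal.mem_mk' ..

theorem TwoSidedIdeal.mem_rightAnnihilator {I : TwoSidedIdeal T} {w : T} :
    w ∈ I.rightAnnihilator ↔ ∀ z ∈ I, z * w = 0 :=
  TwoSidedIdeal.mem_mk' ..

theorem TwoSidedIdeal.mem_rightAnnihilator_sandwichAnnihilator (y : T) :
    y ∈ (sandwichAnnihilator y).rightAnnihilator :=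
  mem_rightAnnihilator.2 fun z hz => by simpa using mem_sandwichAnnihilator.1 hz 1

theorem IsPrimeRing.eq_zero_or_eq_zero (h : IsPrimeRing T) {x y : T}
    (hxy : ∀ t, x * t * y = 0) : x = 0 ∨ y = 0 := by
  have hx := TwoSidedIdeal.mem_sandwichAnnihilator.2 hxy
  have hy := TwoSidedIdeal.mem_rightAnnihilator_sandwichAnnihilator y
  refine (h (.sandwichAnnihilator y) (.rightAnnihilator (.sandwichAnnihilator y))
    fun z hz w hw => TwoSidedIdeal.mem_rightAnnihilator.1 hw z hz).imp (fun h => ?_) fun h => ?_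
  · rwa [h, TwoSidedIdeal.mem_bot] at hx
  · rwa [h, TwoSidedIdeal.mem_bot] at hy

theorem IsSemiprimeRing.eq_zero (h : IsSemiprimeRing T) {x : T}
    (hx : ∀ t, x * t * x = 0) : x = 0 := by
  have hbot := h (TwoSidedIdeal.sandwichAnnihilator x ⊓
    (TwoSidedIdeal.sandwichAnnihilator x).rightAnnihilator) fun z hz w hw =>
      TwoSidedIdeal.mem_rightAnnihilator.1 ((TwoSidedIdeal.mem_inf T).1 hw).2 z
        ((TwoSidedIdeal.mem_inf T).1 hz).1
  rw [← TwoSidedIdeal.mem_bot, ← hbot, TwoSidedIdeal.mem_inf]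
  exact ⟨TwoSidedIdeal.mem_sandwichAnnihilator.2 hx,
    TwoSidedIdeal.mem_rightAnnihilator_sandwichAnnihilator x⟩

theorem IsPrimeRing.isSemiprimeRing (h : IsPrimeRing T) : IsSemiprimeRing T :=
  fun I hI => (h I I hI).elim id id

/-- Under the ascending chain condition on left annihilators, a nonempty family of elements
contains one whose left annihilator is maximal. -/
theorem ACCLeftAnnihilators.exists_maximal (h : ACCLeftAnnihilators T) {P : T → Prop}
    (hP : ∃ b, P b) :
    ∃ b, P b ∧ ∀ c, P c → (∀ t, t * b = 0 → t * c = 0) → ∀ t, t * c = 0 → t * b = 0 := by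
  by_contra! hcon
  have hstep : ∀ b : {b // P b}, ∃ c : {c // P c},
      (∀ t, t * b.1 = 0 → t * c.1 = 0) ∧ ∃ t, t * c.1 = 0 ∧ t * b.1 ≠ 0 := fun b => by
    obtain ⟨c, hc, h1, h2⟩ := hcon b.1 b.2
    exact ⟨⟨c, hc⟩, h1, h2⟩
  choose g hg hg' using hstep
  obtain ⟨b, hb⟩ := hP
  let f : ℕ → {b // P b} := fun n => g^[n] ⟨b, hb⟩
  have hf : ∀ n, f (n + 1) = g (f n) := fun n => Function.iterate_succ_apply' ..
  obtain ⟨n, hn⟩ := h (fun n => lAnnSet T {(f n).1}) (fun n => ⟨_, rfl⟩)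
    (monotone_nat_of_le_succ fun n t ht => by
      simp only [mem_lAnnSet, Set.mem_singleton_iff, forall_eq] at ht ⊢
      rw [hf]
      exact hg _ t ht)
  obtain ⟨t, ht, ht'⟩ := hg' (f n)
  have := hn (n + 1) n.le_succ
  have ht2 : t ∈ lAnnSet T {(f (n + 1)).1} := by simpa [mem_lAnnSet, hf] using ht
  rw [this] at ht2
  exact ht' (ht2 _ rfl)

theorem mul_pow_succ_eq (a u : T) (n : ℕ) : (a * u) ^ (n + 1) = a * (u * a) ^ n * u := by
  induction n with
  | zero => simp
  | succ n ih => rw [pow_succ, ih, pow_succ]; simp only [mul_assoc]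

/-- Levitzki's lemma: a nonzero left ideal of a semiprime ring with the ascending chain condition
on left annihilators is not nil. -/
theorem IsSemiprimeRing.exists_not_isNilpotent (hT : IsSemiprimeRing T)
    (hacc : ACCLeftAnnihilators T) {K : Ideal T} {a : T} (ha : a ∈ K) (ha0 : a ≠ 0) :
    ∃ y ∈ K, ¬ IsNilpotent y := by
  by_contra! hnil
  obtain ⟨b, ⟨hb0, t, rfl⟩, hmax⟩ := hacc.exists_maximal
    (P := fun b => b ≠ 0 ∧ ∃ t, b = a * t) ⟨a, ha0, 1, by simp⟩
  refine hb0 (hT.eq_zero fun r => ?_)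
  set z := a * t * r with hz
  have hznil : IsNilpotent z := by
    obtain ⟨n, hn⟩ := hnil (t * r * a) (K.mul_mem_left _ ha)
    exact ⟨n + 1, by rw [hz, mul_assoc, mul_pow_succ_eq, hn, mul_zero, zero_mul]⟩
  by_cases hz0 : z = 0
  · rw [hz0, zero_mul]
  have hex : ∃ n, z ^ (n + 2) = 0 := by
    obtain ⟨n, hn⟩ := hznil
    exact ⟨n, by rw [pow_add, hn, zero_mul]⟩
  classical
  obtain ⟨k, hk, hk'⟩ : ∃ k, z ^ (k + 1) ≠ 0 ∧ z ^ (k + 2) = 0 := by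
    refine ⟨Nat.find hex, ?_, Nat.find_spec hex⟩
    rcases hm : Nat.find hex with _ | m
    · simpa using hz0
    · exact Nat.find_min hex (hm ▸ m.lt_succ_self)
  refine hmax (z ^ (k + 1)) ⟨hk, t * r * z ^ k, ?_⟩ (fun s hs => ?_) z ?_
  · rw [pow_succ', hz]; simp only [mul_assoc]
  · rw [pow_succ', hz, ← mul_assoc, ← mul_assoc, hs, zero_mul, zero_mul]
  · rw [← pow_succ', hk']

theorem IsSemiprimeRing.exists_lAnn_mul_self_eq (hT : IsSemiprimeRing T)
    (hacc : ACCLeftAnnihilators T) {K : Ideal T} {a : T} (ha : a ∈ K) (ha0 : a ≠ 0) :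
    ∃ y ∈ K, y ≠ 0 ∧ ∀ t, t * y * y = 0 → t * y = 0 := by
  obtain ⟨y, hy, hnil⟩ := hT.exists_not_isNilpotent hacc ha ha0
  obtain ⟨b, ⟨n, rfl⟩, hmax⟩ := hacc.exists_maximal
    (P := fun b => ∃ n, b = y ^ (n + 1)) ⟨y, 0, by simp⟩
  refine ⟨y ^ (n + 1), by rw [pow_succ]; exact K.mul_mem_left _ hy, fun h => hnil ⟨_, h⟩,
    fun t ht => ?_⟩
  refine hmax (y ^ (n + 1) * y ^ (n + 1)) ⟨n + 1 + n, by rw [← pow_add]; congr 1⟩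
    (fun s hs => ?_) t ?_
  · rw [← mul_assoc, hs, zero_mul]
  · rwa [← mul_assoc]

/-- An essential left ideal of a semiprime left Goldie ring contains a finite set whose left
annihilator is zero. -/
theorem IsSemiprimeRing.exists_finset_lAnn_eq_zero (hT : IsSemiprimeRing T)
    (hG : IsLeftGoldie T) {L : Ideal T} (hL : ∀ x ≠ 0, ∃ t, t * x ∈ L ∧ t * x ≠ 0) :
    ∃ s : Finset T, (∀ y ∈ s, y ∈ L) ∧ ∀ x, (∀ y ∈ s, x * y = 0) → x = 0 := by
  by_contra! hcon
  obtain ⟨f, hf, hf'⟩ := exists_seq_of_forall_finset_exists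
    (fun y => y ∈ L ∧ y ≠ 0 ∧ ∀ t, t * y * y = 0 → t * y = 0) (fun y z => z * y = 0)
    fun s hs => by
      obtain ⟨x, hx, hx0⟩ := hcon s fun y hy => (hs y hy).1
      obtain ⟨t, ht, ht0⟩ := hL x hx0
      obtain ⟨y, hy, hy'⟩ := hT.exists_lAnn_mul_self_eq hG.2 (K := L ⊓ lAnnSet T s)
        (Submodule.mem_inf.2 ⟨ht, fun u hu => by rw [mul_assoc, hx u hu, mul_zero]⟩) ht0
      exact ⟨y, ⟨hy.1, hy'⟩, fun u hu => hy.2 u hu⟩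
  refine hG.1 ⟨fun n => Ideal.span {f n}, ?_, fun n => by simpa using (hf n).2.1⟩
  rw [iSupIndep_iff_finsetSum_eq_zero_imp_eq_zero]
  intro s v hv hsum i
  induction i using Nat.strong_induction_on with
  | _ i ih =>
    intro hi
    have hmul : v i * f i = 0 := by
      have h0 := congrArg (· * f i) hsum
      simp only [Finset.sum_mul, zero_mul] at h0
      rwa [Finset.sum_eq_single_of_mem i hi] at h0
      intro j hj hji
      rcases lt_or_gt_of_ne hji with hlt | hgt
      · rw [ih j hlt hj, zero_mul]
      · obtain ⟨c, hc⟩ := Ideal.mem_span_singleton'.1 (hv j hj)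
        rw [← hc, mul_assoc, hf' i j hgt, mul_zero]
    obtain ⟨c, hc⟩ := Ideal.mem_span_singleton'.1 (hv i hi)
    rw [← hc] at hmul ⊢
    exact (hf i).2.2 c hmul

end Semiprime

namespace Subring

variable {S : Type u} [Ring S] {A : Subring S}

theorem accLeftAnnihilators (A : Subring S) (h : ACCLeftAnnihilators S) :
    ACCLeftAnnihilators A := by
  intro f hf hmono
  obtain ⟨n, hn⟩ := h (fun n => lAnnSet S {u | ∃ w : A, w = u ∧ ∀ t ∈ f n, t * w = 0})
    (fun n => ⟨_, rfl⟩) fun m n hmn t ht u ⟨w, hw, hw'⟩ =>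
      ht u ⟨w, hw, fun s hs => hw' s (hmono hmn hs)⟩
  have key : ∀ m (t : A),
      t ∈ f m ↔ (t : S) ∈ lAnnSet S {u | ∃ w : A, w = u ∧ ∀ t ∈ f m, t * w = 0} := by
    intro m t
    constructor
    · rintro ht _ ⟨w, rfl, hw⟩
      exact congrArg Subtype.val (hw t ht)
    · intro ht
      obtain ⟨U, hU⟩ := hf m
      rw [hU]
      intro u hu
      refine Subtype.ext (ht u ⟨u, rfl, fun s hs => ?_⟩)
      rw [hU] at hs
      exact hs u hu
  refine ⟨n, fun m hm => ?_⟩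
  ext t
  rw [key, key]
  exact iff_of_eq (congrArg ((t : S) ∈ ·) (hn m hm))

namespace NicelyEssential

theorem exists_mul_mem (hA : A.NicelyEssential) {x : S} (hx : x ≠ 0) :
    ∃ a : A, (a : S) * x ∈ A ∧ (a : S) * x ≠ 0 := by
  obtain ⟨a, ha, h⟩ := hA {x} (by simpa using hx)
  exact ⟨⟨a, ha⟩, h x (by simp)⟩

theorem isLeftGoldie (hA : A.NicelyEssential) (hS : IsLeftGoldie S) : IsLeftGoldie A := by
  classical
  refine ⟨?_, A.accLeftAnnihilators hS.2⟩
  rintro ⟨f, hf, hf0⟩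
  choose x hx hx0 using fun n => (Submodule.ne_bot_iff _).1 (hf0 n)
  refine hS.1 ⟨fun n => Ideal.span {(x n : S)}, ?_, fun n => by simpa using hx0 n⟩
  rw [iSupIndep_iff_finsetSum_eq_zero_imp_eq_zero] at hf ⊢
  intro s v hv hsum i hi
  by_contra hvi
  have hc : ∀ j, ∃ c : S, j ∈ s → c * x j = v j := fun j => by
    by_cases hj : j ∈ s
    · obtain ⟨c, hc⟩ := Ideal.mem_span_singleton'.1 (hv j hj)
      exact ⟨c, fun _ => hc⟩
    · exact ⟨0, fun h => (hj h).elim⟩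
  choose c hc using hc
  obtain ⟨a, -, ha⟩ := hA (((s.image c) ∪ s.image v).filter (· ≠ 0)) (by simp)
  have hac : ∀ j ∈ s, a * c j ∈ A := fun j hj => by
    by_cases h0 : c j = 0
    · simp [h0]
    · exact (ha (c j) (by simp only [Finset.mem_filter, Finset.mem_union, Finset.mem_image]
                          exact ⟨.inl ⟨j, hj, rfl⟩, h0⟩)).1
  let w : ℕ → A := fun j => if h : j ∈ s then ⟨a * c j, hac j h⟩ * x j else 0
  have hw : ∀ j ∈ s, (w j : S) = a * v j := fun j hj => by
    simp [w, hj, ← hc j hj, mul_assoc]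
  refine (ha (v i) (by simp only [Finset.mem_filter, Finset.mem_union, Finset.mem_image]
                       exact ⟨.inr ⟨i, hi, rfl⟩, hvi⟩)).2 ?_
  suffices h : w i = 0 by rw [← hw i hi, h, ZeroMemClass.coe_zero]
  refine hf s w (fun j hj => ?_) ?_ i hi
  · simp only [w, dif_pos hj]
    exact (f j).mul_mem_left _ (hx j)
  · apply Subtype.ext
    rw [AddSubmonoidClass.coe_finsetSum, Finset.sum_congr rfl hw, ← Finset.mul_sum, hsum]
    simp

theorem isPrimeRing (hA : A.NicelyEssential) (hS : IsPrimeRing S) (hA' : IsSemiprimeRing A) :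
    IsPrimeRing A := by
  intro I J hIJ
  have hJI : ∀ y ∈ J, ∀ x ∈ I, y * x = 0 := fun y hy x hx => hA'.eq_zero fun t => by
    rw [show y * x * t * (y * x) = y * (x * t * y) * x by simp only [mul_assoc],
      hIJ _ (I.mul_mem_right _ _ hx) _ hy, mul_zero, zero_mul]
  by_contra! hne
  have hex : ∀ K : TwoSidedIdeal A, K ≠ ⊥ → ∃ x ∈ K, x ≠ 0 := fun K hK => by
    by_contra! h
    refine hK (le_bot_iff.1 fun x hx => ?_)
    rw [h x hx]
    exact zero_mem _
  obtain ⟨x, hx, hx0⟩ := hex I hne.1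
  obtain ⟨y, hy, hy0⟩ := hex J hne.2
  have hxy : ∀ s : S, (x : S) * s * y = 0 := fun s => by
    by_contra h0
    obtain ⟨a, haA, ha0⟩ := hA.exists_mul_mem h0
    refine ha0 (congrArg Subtype.val (hA'.eq_zero (x := ⟨_, haA⟩) fun b => Subtype.ext ?_))
    have := congrArg Subtype.val (hJI y hy (b * a * x) (I.mul_mem_left _ _ hx))
    push_cast at this ⊢
    calc (a : S) * (x * s * y) * b * (a * (x * s * y))
        = a * x * s * (y * (b * a * x)) * s * y := by simp only [mul_assoc]
      _ = 0 := by rw [this]; simp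
  rcases hS.eq_zero_or_eq_zero hxy with h | h
  · exact hx0 (Subtype.ext h)
  · exact hy0 (Subtype.ext h)

end NicelyEssential

namespace StronglyNicelyEssential

/-- Finitely many elements of the left ideal of `S` generated by a left ideal `E` of `A` can be
brought into `E` by a common left multiplier whose left annihilator in `A` is zero. -/
theorem exists_common_multiplier (hA : A.StronglyNicelyEssential) (E : Ideal A) (s : Finset S)
    (hs : ∀ y ∈ s, y ∈ Ideal.span (Subtype.val '' (E : Set A))) :
    ∃ c : A, (∀ b : A, b * c = 0 → b = 0) ∧ ∀ y ∈ s, ∃ e ∈ E, (e : S) = c * y := by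
  have hone : ∀ y ∈ Ideal.span (Subtype.val '' (E : Set A)), ∀ t : S,
      ∃ c : A, (∀ b : A, b * c = 0 → b = 0) ∧ ∃ e ∈ E, (e : S) = c * (t * y) := by
    intro y hy
    induction hy using Submodule.span_induction with
    | mem y hy =>
      obtain ⟨e, he, rfl⟩ := hy
      intro t
      obtain ⟨c, hc, hct, hreg⟩ := hA.2 t
      refine ⟨⟨c, hc⟩, fun b hb => Subtype.ext (hreg b b.2 (congrArg Subtype.val hb)),
        ⟨c * t, hct⟩ * e, E.mul_mem_left _ he, by simp [mul_assoc]⟩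
    | zero => exact fun t => ⟨1, fun b hb => by simpa using hb, 0, E.zero_mem, by simp⟩
    | add y z _ _ hy hz =>
      intro t
      obtain ⟨c, hc, e, he, hce⟩ := hy t
      obtain ⟨d, hd, e', he', hde⟩ := hz (c * t)
      refine ⟨d * c, fun b hb => hd b (hc _ (by rwa [mul_assoc])), d * e + e',
        E.add_mem (E.mul_mem_left _ he) he', ?_⟩
      push_cast
      rw [hce, hde]
      simp only [mul_add, mul_assoc]
    | smul r y _ hy =>
      intro t
      obtain ⟨c, hc, e, he, hce⟩ := hy (t * r)
      exact ⟨c, hc, e, he, by rw [hce, smul_eq_mul, mul_assoc t]⟩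
  classical
  induction s using Finset.induction_on with
  | empty => exact ⟨1, fun b hb => by simpa using hb, by simp⟩
  | insert y s _ ih =>
    obtain ⟨c, hc, hcs⟩ := ih fun z hz => hs z (Finset.mem_insert_of_mem hz)
    obtain ⟨d, hd, e, he, hde⟩ := hone y (hs y (Finset.mem_insert_self _ _)) c
    refine ⟨d * c, fun b hb => hd b (hc _ (by rwa [mul_assoc])), fun z hz => ?_⟩
    rcases Finset.mem_insert.1 hz with rfl | hz
    · exact ⟨e, he, by rw [hde]; simp [mul_assoc]⟩
    · obtain ⟨e', he', hce⟩ := hcs z hz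
      exact ⟨d * e', E.mul_mem_left _ he', by simp [hce, mul_assoc]⟩

theorem isSemiprimeRing (hA : A.StronglyNicelyEssential) (hS : IsSemiprimeRing S)
    (hG : IsLeftGoldie S) : IsSemiprimeRing A := by
  intro N hN
  let E : Ideal A := N.rightAnnihilator.asIdeal
  have hE : ∀ e, e ∈ E ↔ ∀ n ∈ N, n * e = 0 := fun e => by
    rw [TwoSidedIdeal.mem_asIdeal, TwoSidedIdeal.mem_rightAnnihilator]
  obtain ⟨s, hs, hs0⟩ := hS.exists_finset_lAnn_eq_zero hG
    (L := Ideal.span (Subtype.val '' (E : Set A))) fun x hx => by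
      obtain ⟨a, haA, ha0⟩ := hA.1.exists_mul_mem hx
      by_cases h : (⟨_, haA⟩ : A) ∈ E
      · exact ⟨a, Ideal.subset_span ⟨_, h, rfl⟩, ha0⟩
      · rw [hE] at h
        push Not at h
        obtain ⟨n, hn, hn0⟩ := h
        refine ⟨n * a, ?_, fun h0 => hn0 (Subtype.ext ?_)⟩
        · refine Ideal.subset_span ⟨n * ⟨_, haA⟩, (hE _).2 fun m hm =>
            hN m hm _ (N.mul_mem_right _ _ hn), ?_⟩
          simp [mul_assoc]
        · simpa [mul_assoc] using h0
  obtain ⟨c, hc, hcs⟩ := hA.exists_common_multiplier E s hs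
  refine le_bot_iff.1 fun n hn => ?_
  rw [TwoSidedIdeal.mem_bot]
  refine hc n (Subtype.ext (hs0 _ fun y hy => ?_))
  obtain ⟨e, he, hce⟩ := hcs y hy
  have := congrArg Subtype.val ((hE e).1 he n hn)
  push_cast at this ⊢
  rwa [mul_assoc, ← hce]

end StronglyNicelyEssential

end Subring

/-- If `A` is a strongly nicely essential subring of a semiprime (resp.
prime) left Goldie ring `S`, then `A` is a semiprime (resp. prime) left Goldie ring. -/
theorem stmt_9 {S : Type u} [Ring S] (A : Subring S) (hA : A.StronglyNicelyEssential) :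
    (IsSemiprimeRing S → IsLeftGoldie S → IsSemiprimeRing ↥A ∧ IsLeftGoldie ↥A) ∧
    (IsPrimeRing S → IsLeftGoldie S → IsPrimeRing ↥A ∧ IsLeftGoldie ↥A) := by
  exact ⟨fun hS hG => ⟨hA.isSemiprimeRing hS hG, hA.1.isLeftGoldie hG⟩, fun hS hG =>
    ⟨hA.1.isPrimeRing hS (hA.isSemiprimeRing hS.isSemiprimeRing hG), hA.1.isLeftGoldie hG⟩⟩
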